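/- arXiv:1910.05859 — 3 statements merged into one kernel-verified Lean document; each statement's English description precedes it below -/
import Mathlib

section
/- Let n = n₁ + n₂ − 1, let s ∈ ℂⁿ be α-sparse, and let W ∈ ℂ^{(n+1)×r} be a matrix with orthonormal columns satisfying ‖W‖_{2,∞} ≤ √(μ c_s r/n). Then for every integer a ≥ 0, ‖(Ĥ(s))^a W‖_{2,∞} ≤ √(μ c_s r/n) · (αn‖s‖_∞)^a, where Ĥ(s) is the Hermitian augmentation of the Hankel matrix ℋ(s). -/
open Matrix
open scoped BigOperators

noncomputable section

namespace ASAP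

/-- The Hankel operator `ℋ : ℂⁿ → ℂ^{n₁×n₂}`, `[ℋ(x)]_{i,j} = x_{i+j}`. -/
def hankel {n₁ n₂ n : ℕ} (hn : n + 1 = n₁ + n₂) (x : Fin n → ℂ) :
    Matrix (Fin n₁) (Fin n₂) ℂ :=
  Matrix.of fun i j => x ⟨i.1 + j.1, by have hi := i.2; have hj := j.2; omega⟩

open Classical in
/-- The left inverse `ℋ†` of the Hankel operator: averages over antidiagonals. -/
def hankelDagger {n₁ n₂ n : ℕ} (_hn : n + 1 = n₁ + n₂)
    (M : Matrix (Fin n₁) (Fin n₂) ℂ) : Fin n → ℂ := fun t =>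
  (((Finset.univ.filter fun p : Fin n₁ × Fin n₂ => p.1.1 + p.2.1 = t.1).card : ℂ))⁻¹ *
    ∑ p ∈ Finset.univ.filter fun p : Fin n₁ × Fin n₂ => p.1.1 + p.2.1 = t.1, M p.1 p.2

/-- Spectral norm (largest singular value) of a matrix. -/
def specNorm {m n : Type*} [Fintype m] [Fintype n] [DecidableEq n]
    (M : Matrix m n ℂ) : ℝ :=
  ‖LinearMap.toContinuousLinearMap (Matrix.toEuclideanLin M)‖

/-- Frobenius norm of a matrix. -/
def frobNorm {m n : Type*} [Fintype m] [Fintype n] (M : Matrix m n ℂ) : ℝ :=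
  Real.sqrt (∑ i, ∑ j, ‖M i j‖ ^ 2)

/-- `‖·‖_{2,∞}`: maximum ℓ₂ norm of the rows of a matrix. -/
def rowNorm {m n : Type*} [Fintype m] [Fintype n] (M : Matrix m n ℂ) : ℝ :=
  ⨆ i, Real.sqrt (∑ j, ‖M i j‖ ^ 2)

/-- Entrywise max norm of a matrix. -/
def maxNorm {m n : Type*} [Fintype m] [Fintype n] (M : Matrix m n ℂ) : ℝ :=
  ⨆ i, ⨆ j, ‖M i j‖

/-- ℓ∞ norm of a vector. -/
def vecMaxNorm {n : Type*} [Fintype n] (v : n → ℂ) : ℝ :=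
  ⨆ t, ‖v t‖

/-- ℓ₂ norm of a vector. -/
def vecTwoNorm {n : Type*} [Fintype n] (v : n → ℂ) : ℝ :=
  Real.sqrt (∑ t, ‖v t‖ ^ 2)

/-- The augmented Hermitian matrix `[[0, M], [Mᴴ, 0]]`. -/
def aug {m n : Type*} (M : Matrix m n ℂ) : Matrix (m ⊕ n) (m ⊕ n) ℂ :=
  Matrix.fromBlocks 0 M Mᴴ 0

open Classical in
/-- Support (set of indices of nonzero entries) of a vector. -/
def supp {n : Type*} [Fintype n] (v : n → ℂ) : Finset n :=
  Finset.univ.filter fun t => v t ≠ 0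

/-- `α`-sparsity: at most `α·n` nonzero entries. -/
def IsSparse {n : ℕ} (α : ℝ) (s : Fin n → ℂ) : Prop :=
  ((supp s).card : ℝ) ≤ α * n

/-- The hard thresholding operator `T_ζ`. -/
def hardThreshold {n : ℕ} (ζ : ℝ) (v : Fin n → ℂ) : Fin n → ℂ := fun t =>
  if ζ < ‖v t‖ then v t else 0

/-- `c_s = max {n/n₁, n/n₂}`. -/
def csConst (n₁ n₂ n : ℕ) : ℝ :=
  max ((n : ℝ) / n₁) ((n : ℝ) / n₂)

/-- `(U, σ, V)` is a (compact, rank-`r`, positive and ordered) singular value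
decomposition of `L`, i.e. `L = U Σ V*` with orthonormal columns. -/
def IsSVD {m n : Type*} [Fintype m] [Fintype n] {r : ℕ}
    (L : Matrix m n ℂ) (U : Matrix m (Fin r) ℂ) (σ : Fin r → ℝ)
    (V : Matrix n (Fin r) ℂ) : Prop :=
  Uᴴ * U = 1 ∧ Vᴴ * V = 1 ∧ (∀ i, 0 < σ i) ∧ (∀ i j : Fin r, i ≤ j → σ j ≤ σ i) ∧
    L = U * Matrix.diagonal (fun i => (σ i : ℂ)) * Vᴴ

/-- `μ`-incoherence of a rank-`r` matrix (with respect to `c_s` and `n`). -/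
def IsIncoherent {m n' : Type*} [Fintype m] [Fintype n'] (r n : ℕ) (μ cs : ℝ)
    (L : Matrix m n' ℂ) : Prop :=
  ∃ (U : Matrix m (Fin r) ℂ) (σ : Fin r → ℝ) (V : Matrix n' (Fin r) ℂ),
    IsSVD L U σ V ∧ rowNorm U ≤ Real.sqrt (μ * cs * r / n) ∧
      rowNorm V ≤ Real.sqrt (μ * cs * r / n)

/-- Orthogonal projection onto the tangent space determined by `U` and `V`:
`P_T M = UU*M + MVV* − UU*MVV*`. -/
def tangentProj {m n : Type*} [Fintype m] [Fintype n] {r : ℕ}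
    (U : Matrix m (Fin r) ℂ) (V : Matrix n (Fin r) ℂ)
    (M : Matrix m n ℂ) : Matrix m n ℂ :=
  U * Uᴴ * M + M * (V * Vᴴ) - U * Uᴴ * M * (V * Vᴴ)

/-- `L` is a best rank-`r` approximation of `A` with respect to the norm `nrm`. -/
def IsBestApproxWrt {m n : Type*} [Fintype m] [Fintype n] (r : ℕ)
    (nrm : Matrix m n ℂ → ℝ) (A L : Matrix m n ℂ) : Prop :=
  L.rank ≤ r ∧ ∀ B : Matrix m n ℂ, B.rank ≤ r → nrm (A - L) ≤ nrm (A - B)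

/-- Best rank-`r` approximation in Frobenius norm (truncated SVD, `D_r`). -/
def IsBestRankApprox {m n : Type*} [Fintype m] [Fintype n] (r : ℕ)
    (A L : Matrix m n ℂ) : Prop :=
  IsBestApproxWrt r frobNorm A L

/-- Horizontal concatenation of two matrices. -/
def hcat {m a b : Type*} (A : Matrix m a ℂ) (B : Matrix m b ℂ) :
    Matrix m (a ⊕ b) ℂ :=
  Matrix.of fun i => Sum.elim (A i) (B i)


/-- Sum of absolute values is bounded by sparsity times max. -/
lemma sum_norm_le {n : ℕ} (α : ℝ) (s : Fin n → ℂ) (hs : IsSparse α s) :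
    ∑ t, ‖s t‖ ≤ α * n * vecMaxNorm s := by
  classical
  have hle : ∀ t, ‖s t‖ ≤ vecMaxNorm s := fun t =>
    le_ciSup (f := fun t => ‖s t‖) (Set.finite_range _).bddAbove t
  have h0 : 0 ≤ vecMaxNorm s := Real.iSup_nonneg fun t => norm_nonneg _
  have h1 : ∑ t, ‖s t‖ = ∑ t ∈ supp s, ‖s t‖ := by
    symm
    apply Finset.sum_subset (Finset.subset_univ _)
    intro t _ ht
    simpa [supp] using ht
  rw [h1]
  calc ∑ t ∈ supp s, ‖s t‖ ≤ (supp s).card • vecMaxNorm s :=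
        Finset.sum_le_card_nsmul _ _ _ fun t _ => hle t
    _ = ((supp s).card : ℝ) * vecMaxNorm s := nsmul_eq_mul _ _
    _ ≤ _ := mul_le_mul_of_nonneg_right hs h0

lemma sum_comp_le {m n : ℕ} (s : Fin n → ℂ) (f : Fin m → Fin n)
    (hf : Function.Injective f) : ∑ j, ‖s (f j)‖ ≤ ∑ t, ‖s t‖ := by
  classical
  rw [← Finset.sum_image (s := Finset.univ) (g := f) (f := fun t => ‖s t‖) hf.injOn]
  exact Finset.sum_le_sum_of_subset_of_nonneg (Finset.subset_univ _)
    fun _ _ _ => norm_nonneg _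

lemma aug_row_le {n₁ n₂ n : ℕ} (hn : n + 1 = n₁ + n₂) (s : Fin n → ℂ)
    (i : Fin n₁ ⊕ Fin n₂) : ∑ k, ‖aug (hankel hn s) i k‖ ≤ ∑ t, ‖s t‖ := by
  rcases i with i | i
  · simp only [aug, hankel, Fintype.sum_sum_type, Matrix.fromBlocks_apply₁₁,
      Matrix.fromBlocks_apply₁₂, Matrix.zero_apply, norm_zero, Finset.sum_const_zero,
      zero_add, Matrix.of_apply]
    exact sum_comp_le s (fun j : Fin n₂ => ⟨i.1 + j.1, by omega⟩) fun a b h => by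
      simp only [Fin.mk.injEq] at h
      exact Fin.ext (by omega)
  · simp only [aug, hankel, Fintype.sum_sum_type, Matrix.fromBlocks_apply₂₁,
      Matrix.fromBlocks_apply₂₂, Matrix.zero_apply, norm_zero, Finset.sum_const_zero,
      add_zero, Matrix.of_apply, Matrix.conjTranspose_apply, norm_star]
    exact sum_comp_le s (fun j : Fin n₁ => ⟨j.1 + i.1, by omega⟩) fun a b h => by
      simp only [Fin.mk.injEq] at h
      exact Fin.ext (by omega)

lemma rowNorm_nonneg {m n : Type*} [Fintype m] [Fintype n] (M : Matrix m n ℂ) :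
    0 ≤ rowNorm M := Real.iSup_nonneg fun _ => Real.sqrt_nonneg _

lemma rowNorm_mul_le {m n : Type*} [Fintype m] [Fintype n] (A : Matrix m m ℂ)
    (X : Matrix m n ℂ) (C : ℝ) (hC : 0 ≤ C) (hA : ∀ i, ∑ k, ‖A i k‖ ≤ C) :
    rowNorm (A * X) ≤ C * rowNorm X := by
  have hrow : ∀ (Y : Matrix m n ℂ) i, Real.sqrt (∑ j, ‖Y i j‖ ^ 2) =
      ‖(WithLp.toLp 2 (Y i) : EuclideanSpace ℂ n)‖ := fun Y i => by
    rw [EuclideanSpace.norm_eq]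
  apply Real.iSup_le _ (mul_nonneg hC (rowNorm_nonneg X))
  intro i
  rw [hrow]
  have h : (WithLp.toLp 2 ((A * X) i) : EuclideanSpace ℂ n) =
      ∑ k, A i k • (WithLp.toLp 2 (X k) : EuclideanSpace ℂ n) := by
    ext j
    simp [Matrix.mul_apply]
  rw [h]
  calc _ ≤ ∑ k, ‖A i k • (WithLp.toLp 2 (X k) : EuclideanSpace ℂ n)‖ := norm_sum_le _ _
    _ ≤ ∑ k, ‖A i k‖ * rowNorm X := by
        apply Finset.sum_le_sum
        intro k _
        rw [norm_smul, ← hrow]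
        exact mul_le_mul_of_nonneg_left
          (le_ciSup (f := fun i => Real.sqrt (∑ j, ‖X i j‖ ^ 2))
            (Set.finite_range _).bddAbove k) (norm_nonneg _)
    _ = (∑ k, ‖A i k‖) * rowNorm X := by rw [Finset.sum_mul]
    _ ≤ _ := mul_le_mul_of_nonneg_right (hA i) (rowNorm_nonneg X)

/-- powers of the augmented sparse Hankel matrix applied to an
incoherent orthonormal matrix. -/
theorem statement10 {n₁ n₂ n r : ℕ} (hn : n + 1 = n₁ + n₂) (α μ : ℝ)
    (s : Fin n → ℂ) (hs : IsSparse α s)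
    (W : Matrix (Fin n₁ ⊕ Fin n₂) (Fin r) ℂ) (hW : Wᴴ * W = 1)
    (hWinc : rowNorm W ≤ Real.sqrt (μ * csConst n₁ n₂ n * r / n)) :
    ∀ a : ℕ, rowNorm ((aug (hankel hn s)) ^ a * W) ≤
      Real.sqrt (μ * csConst n₁ n₂ n * r / n) * (α * n * vecMaxNorm s) ^ a := by
  have hsum := sum_norm_le α s hs
  have hC : 0 ≤ α * n * vecMaxNorm s :=
    (Finset.sum_nonneg fun _ _ => norm_nonneg _).trans hsum
  intro a
  induction a with
  | zero => simpa using hWinc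
  | succ a ih =>
    rw [pow_succ', Matrix.mul_assoc]
    refine (rowNorm_mul_le _ _ _ hC fun i => (aug_row_le hn s i).trans hsum).trans ?_
    refine (mul_le_mul_of_nonneg_left ih hC).trans (le_of_eq ?_)
    ring

end ASAP
end
end

section
/- Let n = n₁ + n₂ − 1, let x ∈ ℂⁿ be such that L = ℋ(x) has rank r with singular values σ₁ ≥ ⋯ ≥ σ_r > 0 and condition number κ = σ₁/σ_r, and let s ∈ ℂⁿ be α-sparse with α ≤ c/(μ c_s r κ)² for a sufficiently small absolute constant c > 0. Set z = x + s, τ = 4αμ c_s r κ, β = μ c_s r/(2κn), and fix γ ∈ (0,1) and k ≥ 0. Let L_k be a rank-r matrix and x_k ∈ ℂⁿ with ‖L − L_k‖₂ ≤ 2τγ^k σ_r and ‖x − x_k‖_∞ ≤ ((τ − 2τ²)/(8ακn))γ^k σ_r, set ζ_{k+1} = β γ^k σ₁(L_k) and s_{k+1} = T_{ζ_{k+1}}(z − x_k). Then supp(s_{k+1}) ⊆ supp(s) and ‖s − s_{k+1}‖_∞ ≤ (τ/(4ακn))γ^k σ_r. -/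
open Matrix
open scoped BigOperators

noncomputable section

namespace ASAP

open scoped Matrix.Norms.L2Operator in
theorem specNorm_eq_l2 {m n : Type*} [Fintype m] [Fintype n] [DecidableEq m] [DecidableEq n]
    (M : Matrix m n ℂ) : specNorm M = ‖M‖ := rfl

open scoped Matrix.Norms.L2Operator in
theorem l2_isometry {m : Type*} [Fintype m] [DecidableEq m] {r : ℕ}
    (U : Matrix m (Fin r) ℂ) (h : Uᴴ * U = 1) (hr : 0 < r) : ‖U‖ = 1 := by
  haveI : Nonempty (Fin r) := ⟨⟨0, hr⟩⟩
  have h1 := Matrix.l2_opNorm_conjTranspose_mul_self U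
  have h2 : ‖(1 : Matrix (Fin r) (Fin r) ℂ)‖ = 1 := by
    rw [← Matrix.diagonal_one, Matrix.l2_opNorm_diagonal]
    simp
  rw [h, h2] at h1
  nlinarith [norm_nonneg U]

open scoped Matrix.Norms.L2Operator in
theorem specNorm_svd {n₁ n₂ r : ℕ} (hr : 0 < r) (L : Matrix (Fin n₁) (Fin n₂) ℂ)
    (U : Matrix (Fin n₁) (Fin r) ℂ) (σ : Fin r → ℝ) (V : Matrix (Fin n₂) (Fin r) ℂ)
    (h : IsSVD L U σ V) : specNorm L = σ ⟨0, hr⟩ := by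
  obtain ⟨hU, hV, hpos, hord, hL⟩ := h
  have nU := l2_isometry U hU hr
  have nV := l2_isometry V hV hr
  have nUH : ‖Uᴴ‖ = 1 := by rw [Matrix.l2_opNorm_conjTranspose, nU]
  have nVH : ‖Vᴴ‖ = 1 := by rw [Matrix.l2_opNorm_conjTranspose, nV]
  have nD : ‖Matrix.diagonal (fun i => (σ i : ℂ))‖ = σ ⟨0, hr⟩ := by
    rw [Matrix.l2_opNorm_diagonal]
    apply le_antisymm
    · rw [pi_norm_le_iff_of_nonneg (hpos _).le]
      intro i
      rw [Complex.norm_real, Real.norm_of_nonneg (hpos i).le]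
      exact hord _ _ (Fin.mk_le_of_le_val (Nat.zero_le _))
    · have := norm_le_pi_norm (fun i => (σ i : ℂ)) ⟨0, hr⟩
      simpa [Complex.norm_real, abs_of_pos (hpos ⟨0, hr⟩)] using this
  rw [specNorm_eq_l2]
  apply le_antisymm
  · rw [hL]
    calc _ ≤ ‖U * Matrix.diagonal (fun i => (σ i : ℂ))‖ * ‖Vᴴ‖ := Matrix.l2_opNorm_mul _ _
      _ ≤ ‖U‖ * ‖Matrix.diagonal (fun i => (σ i : ℂ))‖ * ‖Vᴴ‖ := by
        gcongr; exact Matrix.l2_opNorm_mul _ _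
      _ = _ := by rw [nU, nVH, nD]; ring
  · have e : Matrix.diagonal (fun i => (σ i : ℂ)) = Uᴴ * L * V := by
      rw [hL]
      calc _ = (Uᴴ * U) * Matrix.diagonal (fun i => (σ i : ℂ)) * (Vᴴ * V) := by
            rw [hU, hV]; simp
        _ = _ := by simp only [Matrix.mul_assoc]
    rw [← nD, e]
    calc _ ≤ ‖Uᴴ * L‖ * ‖V‖ := Matrix.l2_opNorm_mul _ _
      _ ≤ ‖Uᴴ‖ * ‖L‖ * ‖V‖ := by gcongr; exact Matrix.l2_opNorm_mul _ _
      _ = _ := by rw [nUH, nV]; ring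

open scoped Matrix.Norms.L2Operator in
theorem specNorm_diff {n₁ n₂ : ℕ} (A B : Matrix (Fin n₁) (Fin n₂) ℂ) :
    |specNorm A - specNorm B| ≤ specNorm (A - B) := by
  simp only [specNorm_eq_l2]
  exact abs_norm_sub_norm_le A B

theorem le_vecMaxNorm {n : ℕ} (v : Fin n → ℂ) (t : Fin n) : ‖v t‖ ≤ vecMaxNorm v :=
  le_ciSup (f := fun t => ‖v t‖) (Set.finite_range _).bddAbove t

/-- support inclusion and entrywise accuracy of the hard
thresholding step. -/
theorem statement12 :
    ∃ c : ℝ, 0 < c ∧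
    ∀ (n₁ n₂ n r : ℕ) (hn : n + 1 = n₁ + n₂), 0 < n₁ → 0 < n₂ → (hr : 0 < r) →
    ∀ (μ α κ cs τ β : ℝ), 0 < μ → 0 < α →
    ∀ (x s : Fin n → ℂ)
      (U : Matrix (Fin n₁) (Fin r) ℂ) (σ : Fin r → ℝ) (V : Matrix (Fin n₂) (Fin r) ℂ),
      IsSVD (hankel hn x) U σ V →
      cs = csConst n₁ n₂ n →
      κ = σ ⟨0, hr⟩ / σ ⟨r - 1, by omega⟩ →
      IsSparse α s →
      α ≤ c / (μ * cs * r * κ) ^ 2 →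
      τ = 4 * α * μ * cs * r * κ →
      β = μ * cs * r / (2 * κ * n) →
    ∀ (γ : ℝ) (k : ℕ), 0 < γ → γ < 1 →
    ∀ (Lk : Matrix (Fin n₁) (Fin n₂) ℂ) (xk : Fin n → ℂ)
      (Uk : Matrix (Fin n₁) (Fin r) ℂ) (σk : Fin r → ℝ) (Vk : Matrix (Fin n₂) (Fin r) ℂ),
      IsSVD Lk Uk σk Vk →
      specNorm (hankel hn x - Lk) ≤ 2 * τ * γ ^ k * σ ⟨r - 1, by omega⟩ →
      vecMaxNorm (x - xk) ≤ (τ - 2 * τ ^ 2) / (8 * α * κ * n) * γ ^ k * σ ⟨r - 1, by omega⟩ →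
      supp (hardThreshold (β * γ ^ k * specNorm Lk) (x + s - xk)) ⊆ supp s ∧
      vecMaxNorm (s - hardThreshold (β * γ ^ k * specNorm Lk) (x + s - xk))
        ≤ τ / (4 * α * κ * n) * γ ^ k * σ ⟨r - 1, by omega⟩ := by
  refine ⟨1, one_pos, ?_⟩
  intro n₁ n₂ n r hn h1 h2 hr μ α κ cs τ β hμ hα x s U σ V hL hcs hκ _ _ hτ hβ γ k hγ0 hγ1
    Lk xk Uk σk Vk hLk hspec hx
  have hspos := hL.2.2.1
  have hord := hL.2.2.2.1 ⟨0, hr⟩ ⟨r - 1, by omega⟩ (Fin.mk_le_of_le_val (Nat.zero_le _))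
  have hA := specNorm_svd hr _ _ _ _ hL
  have hd := (specNorm_diff _ _).trans hspec
  rw [hA, abs_le] at hd
  have hr0 := hspos ⟨r - 1, by omega⟩
  generalize σ ⟨r - 1, by omega⟩ = b at *
  generalize σ ⟨0, hr⟩ = a at *
  generalize specNorm Lk = S at *
  have hn0 : 0 < n := by omega
  haveI : Nonempty (Fin n) := ⟨⟨0, hn0⟩⟩
  have hnR : (0 : ℝ) < n := by exact_mod_cast hn0
  have h1R : (0 : ℝ) < n₁ := by exact_mod_cast h1
  have hrR : (0 : ℝ) < r := by exact_mod_cast hr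
  have hcs0 : 0 < cs := by
    rw [hcs]; exact lt_max_of_lt_left (div_pos hnR h1R)
  have hκ1 : 1 ≤ κ := by rw [hκ, le_div_iff₀ hr0]; linarith
  have hκ0 : 0 < κ := by linarith
  have ha : a = κ * b := by rw [hκ]; field_simp
  have hg0 : 0 < γ ^ k := pow_pos hγ0 k
  have hg1 : γ ^ k ≤ 1 := pow_le_one₀ hγ0.le hγ1.le
  have hτ0 : 0 < τ := by rw [hτ]; positivity
  generalize γ ^ k = g at *
  obtain ⟨E, hE⟩ : ∃ E, E = μ * cs * r / (2 * n) * g * b := ⟨_, rfl⟩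
  have hE0 : 0 < E := by rw [hE]; positivity
  have e1 : (τ - 2 * τ ^ 2) / (8 * α * κ * n) * g * b = (1 - 2 * τ) * E := by
    have : τ - 2 * τ ^ 2 = (1 - 2 * τ) * (4 * α * μ * cs * r * κ) := by
      rw [← hτ]; ring
    rw [this, hE]; field_simp; ring
  have e2 : τ / (4 * α * κ * n) * g * b = 2 * E := by
    rw [hE, hτ]; field_simp
  have hP : 0 < μ * cs * r / (2 * κ * n) * g := by positivity
  have e3 : E = μ * cs * r / (2 * κ * n) * g * (κ * b) := by
    rw [hE]; field_simp
  rw [e1] at hx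
  rw [e2]
  have hw : 2 * τ * g * b ≤ 2 * τ * (κ * b) := by
    have : g * b ≤ κ * b := mul_le_mul_of_nonneg_right (hg1.trans hκ1) hr0.le
    nlinarith
  have hz1 : (1 - 2 * τ) * E ≤ β * g * S := by
    have : (1 - 2 * τ) * (κ * b) ≤ S := by linarith [hd.2]
    have := mul_le_mul_of_nonneg_left this hP.le
    rw [hβ, e3]; linarith
  have hz2 : β * g * S ≤ (1 + 2 * τ) * E := by
    have : S ≤ (1 + 2 * τ) * (κ * b) := by linarith [hd.1]
    have := mul_le_mul_of_nonneg_left this hP.le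
    rw [hβ, e3]; linarith
  generalize β * g * S = ζ at *
  have hxt : ∀ t, ‖x t - xk t‖ ≤ (1 - 2 * τ) * E := fun t =>
    (le_vecMaxNorm (x - xk) t).trans hx
  constructor
  · intro t ht
    simp only [supp, Finset.mem_filter, Finset.mem_univ, true_and] at ht ⊢
    intro hs
    apply ht
    simp only [hardThreshold, Pi.sub_apply, Pi.add_apply, hs, add_zero]
    rw [if_neg]
    exact not_lt.mpr ((hxt t).trans hz1)
  · apply ciSup_le
    intro t
    have hxt' := hxt t
    have hτE : 0 < τ * E := mul_pos hτ0 hE0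
    simp only [hardThreshold, Pi.sub_apply, Pi.add_apply]
    split_ifs with hc
    · have : s t - (x t + s t - xk t) = -(x t - xk t) := by ring
      rw [this, norm_neg]
      linarith
    · have : s t - 0 = (x t + s t - xk t) - (x t - xk t) := by ring
      rw [this]
      have := norm_sub_le (x t + s t - xk t) (x t - xk t)
      linarith

end ASAP
end
end

section
/- Let n = n₁ + n₂ − 1, let x ∈ ℂⁿ be such that L = ℋ(x) has rank r, is μ-incoherent, has singular values σ₁ ≥ ⋯ ≥ σ_r > 0 and condition number κ = σ₁/σ_r, and let s ∈ ℂⁿ be α-sparse with α ≤ c/(μ c_s r κ)² for a sufficiently small absolute constant c > 0. Set z = x + s, τ = 4αμ c_s r κ, υ = 3τ(2√(μ c_s r)κ + μ c_s r κ), β = μ c_s r/(2κn), and let γ satisfy 4τ + √(1/12) ≤ γ < 1. Fix k ≥ 0, let L_k be a rank-r, 4μκ²-incoherent matrix with tangent space T_k, and let x_k ∈ ℂⁿ satisfy ‖L − L_k‖₂ ≤ 2τγ^k σ_r and ‖x − x_k‖_∞ ≤ ((τ − 2τ²)/(8ακn))γ^k σ_r; set ζ_{k+1} = βγ^kσ₁(L_k)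 and s_{k+1} = T_{ζ_{k+1}}(z − x_k). Then ‖(P_{T_k} − I)L + P_{T_k}ℋ(s − s_{k+1})‖₂ ≤ τγ^{k+1}σ_r and ‖(P_{T_k} − I)L + P_{T_k}ℋ(s − s_{k+1})‖_{2,∞} ≤ n^{−1/2} υ γ^k σ_r. -/
open Matrix
open scoped BigOperators

noncomputable section

namespace ASAP

set_option linter.unusedSectionVars false

section Aux

open scoped Matrix.Norms.L2Operator

variable {m n l : Type*} [Fintype m] [Fintype n] [Fintype l]
  [DecidableEq m] [DecidableEq n] [DecidableEq l]

lemma specNorm_eq (M : Matrix m n ℂ) : specNorm M = ‖M‖ := rfl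

lemma lin_le (A : Matrix m n ℂ) (v : EuclideanSpace ℂ n) :
    ‖Matrix.toEuclideanLin A v‖ ≤ ‖A‖ * ‖v‖ :=
  (LinearMap.toContinuousLinearMap (Matrix.toEuclideanLin A)).le_opNorm v

lemma norm_le_of_bilin (A : Matrix m n ℂ) (K : ℝ) (hK : 0 ≤ K)
    (h : ∀ (u : EuclideanSpace ℂ m) (v : EuclideanSpace ℂ n),
      ‖inner ℂ u (Matrix.toEuclideanLin A v)‖ ≤ K * ((‖u‖ ^ 2 + ‖v‖ ^ 2) / 2)) :
    ‖A‖ ≤ K := by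
  rw [← specNorm_eq]
  refine ContinuousLinearMap.opNorm_le_bound _ hK fun v => ?_
  change ‖Matrix.toEuclideanLin A v‖ ≤ K * ‖v‖
  set w := Matrix.toEuclideanLin A v with hw
  by_cases hw0 : w = 0
  · rw [hw0, norm_zero]; positivity
  have hwp : 0 < ‖w‖ := norm_pos_iff.2 hw0
  have hv0 : v ≠ 0 := by
    rintro rfl
    exact hw0 (by simp [hw])
  have hvp : 0 < ‖v‖ := norm_pos_iff.2 hv0
  have h1 := h (((‖v‖ / ‖w‖ : ℝ) : ℂ) • w) v
  rw [← hw, inner_smul_left, inner_self_eq_norm_sq_to_K, norm_smul, norm_mul] at h1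
  simp only [RCLike.norm_conj, Complex.norm_real, norm_div, norm_norm, norm_pow,
    Complex.coe_algebraMap] at h1
  have e1 : ‖v‖ / ‖w‖ * ‖w‖ ^ 2 = ‖v‖ * ‖w‖ := by field_simp
  have e2 : ‖v‖ / ‖w‖ * ‖w‖ = ‖v‖ := by field_simp
  have h2 : ‖v‖ * ‖w‖ ≤ K * ((‖v‖ ^ 2 + ‖v‖ ^ 2) / 2) := by
    rw [← e1]; rw [e2] at h1; simpa using h1
  have : ‖v‖ * ‖w‖ ≤ ‖v‖ * (K * ‖v‖) := by linarith
  exact le_of_mul_le_mul_left this hvp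

lemma lin_mul (A : Matrix m n ℂ) (B : Matrix n l ℂ) (v : EuclideanSpace ℂ l) :
    Matrix.toEuclideanLin (A * B) v = Matrix.toEuclideanLin A (Matrix.toEuclideanLin B v) := by
  rw [Matrix.toLpLin_mul_same]; rfl

lemma inner_lin (A : Matrix m n ℂ) (u : EuclideanSpace ℂ m) (v : EuclideanSpace ℂ n) :
    inner ℂ u (Matrix.toEuclideanLin A v) = inner ℂ (Matrix.toEuclideanLin Aᴴ u) v := by
  rw [Matrix.toEuclideanLin_conjTranspose_eq_adjoint, LinearMap.adjoint_inner_left]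

lemma half_proj (P : Matrix m m ℂ) (hP : P * P = P) (hPs : Pᴴ = P) (u : EuclideanSpace ℂ m) :
    ‖Matrix.toEuclideanLin (1 - (1/2 : ℂ) • P) u‖ ^ 2
      = ‖u‖ ^ 2 - 3 / 4 * ‖Matrix.toEuclideanLin P u‖ ^ 2 := by
  have h1 : inner ℂ u (Matrix.toEuclideanLin P u) = ((‖Matrix.toEuclideanLin P u‖ ^ 2 : ℝ) : ℂ) := by
    conv_lhs => rw [← hP, lin_mul, inner_lin, hPs, inner_self_eq_norm_sq_to_K]
    simp
  have h2 : Matrix.toEuclideanLin (1 - (1/2 : ℂ) • P) u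
      = u - (1/2 : ℂ) • Matrix.toEuclideanLin P u := by
    rw [map_sub, map_smul, Matrix.toLpLin_one]; rfl
  rw [h2, @norm_sub_sq ℂ, inner_smul_right, h1, norm_smul]
  simp only [RCLike.re_to_complex]
  rw [show (1 / 2 : ℂ) * ((‖Matrix.toEuclideanLin P u‖ ^ 2 : ℝ) : ℂ)
    = ((1/2 * ‖Matrix.toEuclideanLin P u‖ ^ 2 : ℝ) : ℂ) by push_cast; ring, Complex.ofReal_re]
  norm_num
  ring

lemma tangent_norm (P : Matrix m m ℂ) (hP : P * P = P) (hPs : Pᴴ = P)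
    (Q : Matrix n n ℂ) (hQ : Q * Q = Q) (hQs : Qᴴ = Q) (M : Matrix m n ℂ) :
    ‖P * M + M * Q - P * M * Q‖ ≤ (4 * Real.sqrt (1 / 12)) * ‖M‖ := by
  set ρ := Real.sqrt (1/12) with hρ
  have hρ0 : 0 < ρ := Real.sqrt_pos.2 (by norm_num)
  have hρ2 : ρ ^ 2 = 1 / 12 := Real.sq_sqrt (by norm_num)
  have hN : P * M + M * Q - P * M * Q
      = P * (M * (1 - (1/2 : ℂ) • Q)) + (1 - (1/2 : ℂ) • P) * (M * Q) := by
    rw [Matrix.mul_sub, Matrix.mul_sub, Matrix.sub_mul, Matrix.mul_smul, Matrix.mul_smul,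
      Matrix.smul_mul, Matrix.mul_one, Matrix.one_mul, ← Matrix.mul_assoc]
    module
  have hX : (1 - (1/2 : ℂ) • P)ᴴ = 1 - (1/2 : ℂ) • P := by
    rw [Matrix.conjTranspose_sub, Matrix.conjTranspose_one, Matrix.conjTranspose_smul, hPs]
    simp
  apply norm_le_of_bilin _ _ (by positivity)
  intro u v
  rw [hN, map_add, LinearMap.add_apply, inner_add_right, lin_mul, lin_mul, lin_mul, lin_mul,
    inner_lin P, inner_lin (1 - (1/2 : ℂ) • P), hPs, hX]
  have hu := half_proj P hP hPs u
  have hv := half_proj Q hQ hQs v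
  set a := Matrix.toEuclideanLin P u
  set b := Matrix.toEuclideanLin (1 - (1/2 : ℂ) • P) u
  set c := Matrix.toEuclideanLin Q v
  set d := Matrix.toEuclideanLin (1 - (1/2 : ℂ) • Q) v
  have k1 : ‖inner ℂ a (Matrix.toEuclideanLin M d)‖ ≤ ‖M‖ * (‖a‖ * ‖d‖) := by
    calc _ ≤ ‖a‖ * ‖Matrix.toEuclideanLin M d‖ := norm_inner_le_norm _ _
      _ ≤ ‖a‖ * (‖M‖ * ‖d‖) := by gcongr; exact lin_le _ _
      _ = _ := by ring
  have k2 : ‖inner ℂ b (Matrix.toEuclideanLin M c)‖ ≤ ‖M‖ * (‖b‖ * ‖c‖) := by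
    calc _ ≤ ‖b‖ * ‖Matrix.toEuclideanLin M c‖ := norm_inner_le_norm _ _
      _ ≤ ‖b‖ * (‖M‖ * ‖c‖) := by gcongr; exact lin_le _ _
      _ = _ := by ring
  have k3 : ‖a‖ * ‖d‖ + ‖b‖ * ‖c‖ ≤ 2 * ρ * (‖u‖ ^ 2 + ‖v‖ ^ 2) := by
    have h1 : ‖a‖ * ‖d‖ ≤ 2 * ρ * (3/4 * ‖a‖ ^ 2 + ‖d‖ ^ 2) := by
      have : 2 * ρ * (3/4 * ‖a‖ ^ 2 + ‖d‖ ^ 2) - ‖a‖ * ‖d‖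
          = 2 * ρ * (‖d‖ - 3 * ρ * ‖a‖) ^ 2 := by
        linear_combination (‖a‖ ^ 2 * (-18 * ρ) + 12 * ‖a‖ * ‖d‖) * hρ2
      have : 0 ≤ 2 * ρ * (‖d‖ - 3 * ρ * ‖a‖) ^ 2 := by positivity
      linarith
    have h2 : ‖b‖ * ‖c‖ ≤ 2 * ρ * (3/4 * ‖c‖ ^ 2 + ‖b‖ ^ 2) := by
      have : 2 * ρ * (3/4 * ‖c‖ ^ 2 + ‖b‖ ^ 2) - ‖b‖ * ‖c‖
          = 2 * ρ * (‖b‖ - 3 * ρ * ‖c‖) ^ 2 := by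
        linear_combination (‖c‖ ^ 2 * (-18 * ρ) + 12 * ‖c‖ * ‖b‖) * hρ2
      have : 0 ≤ 2 * ρ * (‖b‖ - 3 * ρ * ‖c‖) ^ 2 := by positivity
      linarith
    rw [hu] at h2; rw [hv] at h1
    linarith
  calc _ ≤ ‖M‖ * (‖a‖ * ‖d‖) + ‖M‖ * (‖b‖ * ‖c‖) := (norm_add_le _ _).trans (add_le_add k1 k2)
    _ = ‖M‖ * (‖a‖ * ‖d‖ + ‖b‖ * ‖c‖) := by ring
    _ ≤ ‖M‖ * (2 * ρ * (‖u‖ ^ 2 + ‖v‖ ^ 2)) := by gcongr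
    _ = _ := by ring

/-- the norm of a row -/
def rn (M : Matrix m n ℂ) (i : m) : ℝ := Real.sqrt (∑ j, ‖M i j‖ ^ 2)

lemma rn_eq (M : Matrix m n ℂ) (i : m) : rn M i = ‖WithLp.toLp 2 (M i)‖ := by
  rw [EuclideanSpace.norm_eq]; rfl

lemma rn_nonneg (M : Matrix m n ℂ) (i : m) : 0 ≤ rn M i := Real.sqrt_nonneg _

lemma rn_add (A B : Matrix m n ℂ) (i : m) : rn (A + B) i ≤ rn A i + rn B i := by
  simp only [rn_eq]; exact norm_add_le (WithLp.toLp 2 (A i)) (WithLp.toLp 2 (B i))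

lemma rn_neg (A : Matrix m n ℂ) (i : m) : rn (-A) i = rn A i := by
  simp only [rn_eq]; exact norm_neg (WithLp.toLp 2 (A i))

lemma rn_sub (A B : Matrix m n ℂ) (i : m) : rn (A - B) i ≤ rn A i + rn B i := by
  simp only [rn_eq]; exact norm_sub_le (WithLp.toLp 2 (A i)) (WithLp.toLp 2 (B i))

lemma rn_le_rowNorm (A : Matrix m n ℂ) (i : m) : rn A i ≤ rowNorm A :=
  le_ciSup (f := fun i => Real.sqrt (∑ j, ‖A i j‖ ^ 2)) (Set.finite_range _).bddAbove i

lemma rn_mul (A : Matrix m n ℂ) (B : Matrix n l ℂ) (i : m) :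
    rn (A * B) i ≤ rn A i * ‖B‖ := by
  have h := lin_le Bᴴ (WithLp.toLp 2 (star (A i)))
  rw [Matrix.l2_opNorm_conjTranspose] at h
  have e1 : ‖WithLp.toLp 2 (star (A i))‖ = rn A i := by
    rw [EuclideanSpace.norm_eq]; simp [rn]
  have e2 : ‖Matrix.toEuclideanLin Bᴴ (WithLp.toLp 2 (star (A i)))‖ = rn (A * B) i := by
    rw [Matrix.toLpLin_toLp, EuclideanSpace.norm_eq, rn]
    congr 1
    refine Finset.sum_congr rfl fun j _ => ?_
    congr 1
    rw [← norm_star]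
    congr 1
    simp [Matrix.mulVec, dotProduct, Matrix.mul_apply, mul_comm]
  rw [e1, e2] at h
  linarith

lemma rn_mul_l1 (A : Matrix m n ℂ) (B : Matrix n l ℂ) (i : m) (S b : ℝ) (hb : 0 ≤ b)
    (hA : ∑ j, ‖A i j‖ ≤ S) (hB : ∀ j, rn B j ≤ b) :
    rn (A * B) i ≤ S * b := by
  have : (WithLp.toLp 2 ((A * B) i) : EuclideanSpace ℂ l) = ∑ j, A i j • WithLp.toLp 2 (B j) := by
    ext t; simp [Matrix.mul_apply]
  rw [rn_eq, this]
  calc _ ≤ ∑ j, ‖A i j • (WithLp.toLp 2 (B j) : EuclideanSpace ℂ l)‖ := norm_sum_le _ _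
    _ ≤ ∑ j, ‖A i j‖ * b := by
        gcongr with j _
        rw [norm_smul, ← rn_eq]
        gcongr
        exact hB j
    _ = (∑ j, ‖A i j‖) * b := by rw [Finset.sum_mul]
    _ ≤ _ := by gcongr

/-- Schur test. -/
lemma schur_test (A : Matrix m n ℂ) (S : ℝ) (hS : 0 ≤ S) (hr : ∀ i, ∑ j, ‖A i j‖ ≤ S)
    (hc : ∀ j, ∑ i, ‖A i j‖ ≤ S) : ‖A‖ ≤ S := by
  apply norm_le_of_bilin _ _ hS
  intro u v
  have e : inner ℂ u (Matrix.toEuclideanLin A v) = ∑ i, ∑ j, star (u i) * (A i j * v j) := by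
    simp [PiLp.inner_apply, Matrix.mulVec, dotProduct, Finset.mul_sum, mul_comm]
  rw [e]
  calc _ ≤ ∑ i, ∑ j, ‖star (u i) * (A i j * v j)‖ := 
        (norm_sum_le _ _).trans (Finset.sum_le_sum fun i _ => norm_sum_le _ _)
    _ ≤ ∑ i, ∑ j, (‖A i j‖ * ‖u i‖ ^ 2 / 2 + ‖A i j‖ * ‖v j‖ ^ 2 / 2) := by
        gcongr with i _ j _
        rw [norm_mul, norm_mul, norm_star]
        nlinarith [mul_nonneg (norm_nonneg (A i j)) (sq_nonneg (‖u i‖ - ‖v j‖))]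
    _ = ∑ i, (∑ j, ‖A i j‖) * (‖u i‖ ^ 2 / 2) + ∑ j, (∑ i, ‖A i j‖) * (‖v j‖ ^ 2 / 2) := by
        simp only [Finset.sum_add_distrib, Finset.sum_mul, mul_div_assoc]
        congr 1
        exact Finset.sum_comm
    _ ≤ ∑ i, S * (‖u i‖ ^ 2 / 2) + ∑ j, S * (‖v j‖ ^ 2 / 2) := by
        gcongr with i _ j _
        · exact hr i
        · exact hc j
    _ = _ := by
        rw [EuclideanSpace.norm_sq_eq, EuclideanSpace.norm_sq_eq, ← Finset.mul_sum,
          ← Finset.mul_sum, ← Finset.sum_div, ← Finset.sum_div]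
        ring

end Aux
section Aux2

open scoped Matrix.Norms.L2Operator

variable {m n : Type*} [Fintype m] [Fintype n] [DecidableEq m] [DecidableEq n]

lemma specNorm_add (A B : Matrix m n ℂ) : specNorm (A + B) ≤ specNorm A + specNorm B :=
  norm_add_le A B

lemma specNorm_sub (A B : Matrix m n ℂ) : specNorm (A - B) ≤ specNorm A + specNorm B :=
  norm_sub_le A B

lemma herm_idem_norm (R : Matrix m m ℂ) (h : R * R = R) (hs : Rᴴ = R) : ‖R‖ ≤ 1 := by
  have h1 := Matrix.l2_opNorm_conjTranspose_mul_self R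
  rw [hs, h] at h1
  by_contra hc
  push Not at hc
  nlinarith

lemma iso_norm {r : ℕ} (U : Matrix m (Fin r) ℂ) (h : Uᴴ * U = 1) : ‖U‖ ≤ 1 := by
  have h1 := Matrix.l2_opNorm_conjTranspose_mul_self U
  have h2 : ‖(1 : Matrix (Fin r) (Fin r) ℂ)‖ ≤ 1 := herm_idem_norm _ (by simp) (by simp)
  rw [h] at h1
  by_contra hc
  push Not at hc
  nlinarith

lemma proj_idem {r : ℕ} (U : Matrix m (Fin r) ℂ) (h : Uᴴ * U = 1) :
    U * Uᴴ * (U * Uᴴ) = U * Uᴴ := by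
  rw [Matrix.mul_assoc, ← Matrix.mul_assoc Uᴴ U, h, Matrix.one_mul]

lemma proj_herm {r : ℕ} (U : Matrix m (Fin r) ℂ) : (U * Uᴴ)ᴴ = U * Uᴴ := by
  simp

lemma coproj_norm {r : ℕ} (U : Matrix m (Fin r) ℂ) (h : Uᴴ * U = 1) : ‖1 - U * Uᴴ‖ ≤ 1 := by
  apply herm_idem_norm
  · rw [Matrix.sub_mul, Matrix.one_mul, Matrix.mul_sub, Matrix.mul_one, proj_idem U h]; simp
  · simp

lemma norm_mul3 {a b c d : Type*} [Fintype a] [Fintype b] [Fintype c] [Fintype d]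
    [DecidableEq a] [DecidableEq b] [DecidableEq c] [DecidableEq d]
    (A : Matrix a b ℂ) (B : Matrix b c ℂ) (C : Matrix c d ℂ) (hA : ‖A‖ ≤ 1) (hC : ‖C‖ ≤ 1) :
    ‖A * B * C‖ ≤ ‖B‖ := by
  calc _ ≤ ‖A * B‖ * ‖C‖ := Matrix.l2_opNorm_mul _ _
    _ ≤ (‖A‖ * ‖B‖) * ‖C‖ := by gcongr; exact Matrix.l2_opNorm_mul _ _
    _ ≤ (1 * ‖B‖) * 1 := by gcongr
    _ = _ := by ring

lemma svd_norm {r : ℕ} (hr : 0 < r) (L : Matrix m n ℂ) (U : Matrix m (Fin r) ℂ) (σ : Fin r → ℝ)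
    (V : Matrix n (Fin r) ℂ) (h : IsSVD L U σ V) : ‖L‖ = σ ⟨0, hr⟩ := by
  obtain ⟨hU, hV, hpos, hord, hL⟩ := h
  have hd : ‖(Matrix.diagonal (fun i => (σ i : ℂ)))‖ = σ ⟨0, hr⟩ := by
    rw [Matrix.l2_opNorm_diagonal]
    apply le_antisymm
    · rw [pi_norm_le_iff_of_nonneg (hpos _).le]
      intro i
      rw [Complex.norm_real, Real.norm_eq_abs, abs_of_pos (hpos i)]
      exact hord _ _ (Nat.zero_le _)
    · have := norm_le_pi_norm (fun i => (σ i : ℂ)) ⟨0, hr⟩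
      rwa [Complex.norm_real, Real.norm_eq_abs, abs_of_pos (hpos _)] at this
  rw [← hd]
  have hU1 := iso_norm U hU
  have hV1 := iso_norm V hV
  apply le_antisymm
  · rw [hL]
    exact norm_mul3 _ _ _ hU1 (by rwa [Matrix.l2_opNorm_conjTranspose])
  · have e : Matrix.diagonal (fun i => (σ i : ℂ)) = Uᴴ * L * V := by
      rw [hL]
      calc _ = 1 * Matrix.diagonal (fun i => (σ i : ℂ)) * 1 := by simp
        _ = (Uᴴ * U) * Matrix.diagonal (fun i => (σ i : ℂ)) * (Vᴴ * V) := by rw [hU, hV]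
        _ = _ := by simp only [Matrix.mul_assoc]
    rw [e]
    exact norm_mul3 _ _ _ (by rwa [Matrix.l2_opNorm_conjTranspose]) hV1

lemma tangent_resid {r : ℕ} (L Lk : Matrix m n ℂ) (U Uk : Matrix m (Fin r) ℂ) (σ σk : Fin r → ℝ)
    (V Vk : Matrix n (Fin r) ℂ) (h : IsSVD L U σ V) (hk : IsSVD Lk Uk σk Vk) :
    tangentProj Uk Vk L - L
      = -(((1 - Uk * Ukᴴ) * U) * (Uᴴ * (L - Lk) * (1 - Vk * Vkᴴ))) := by
  obtain ⟨hU, hV, hpos, hord, hL⟩ := h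
  obtain ⟨hUk, hVk, -, -, hLk⟩ := hk
  have h1 : U * (Uᴴ * L) = L := by
    rw [hL]; simp only [← Matrix.mul_assoc]
    rw [Matrix.mul_assoc U Uᴴ U, hU, Matrix.mul_one]
  have h2 : Lk * (1 - Vk * Vkᴴ) = 0 := by
    rw [Matrix.mul_sub, Matrix.mul_one, hLk]
    rw [Matrix.mul_assoc _ Vkᴴ, ← Matrix.mul_assoc Vkᴴ, hVk, Matrix.one_mul, sub_self]
  have h3 : Uᴴ * (L - Lk) * (1 - Vk * Vkᴴ) = Uᴴ * L * (1 - Vk * Vkᴴ) := by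
    rw [Matrix.mul_sub Uᴴ L Lk, Matrix.sub_mul, Matrix.mul_assoc _ Lk, h2, Matrix.mul_zero, sub_zero]
  rw [h3, Matrix.mul_assoc _ U, ← Matrix.mul_assoc U, h1, tangentProj]
  simp only [Matrix.sub_mul, Matrix.mul_sub, Matrix.one_mul, Matrix.mul_one, Matrix.mul_assoc]
  abel

lemma angle_bound {r : ℕ} (hr : 0 < r) (L Lk : Matrix m n ℂ) (U Uk : Matrix m (Fin r) ℂ)
    (σ σk : Fin r → ℝ)
    (V Vk : Matrix n (Fin r) ℂ) (h : IsSVD L U σ V) (hk : IsSVD Lk Uk σk Vk) :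
    ‖(1 - Uk * Ukᴴ) * U‖ ≤ ‖L - Lk‖ / σ ⟨r - 1, by omega⟩ := by
  obtain ⟨hU, hV, hpos, hord, hL⟩ := h
  obtain ⟨hUk, hVk, -, -, hLk⟩ := hk
  have h2 : (1 - Uk * Ukᴴ) * Lk = 0 := by
    rw [Matrix.sub_mul, Matrix.one_mul, hLk]
    simp only [← Matrix.mul_assoc]
    rw [Matrix.mul_assoc Uk Ukᴴ, hUk, Matrix.mul_one, sub_self]
  have h3 : L * V = U * Matrix.diagonal (fun i => (σ i : ℂ)) := by
    rw [hL, Matrix.mul_assoc, hV, Matrix.mul_one]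
  have h4 : Matrix.diagonal (fun i => (σ i : ℂ)) * Matrix.diagonal (fun i => ((σ i)⁻¹ : ℂ)) = 1 := by
    rw [Matrix.diagonal_mul_diagonal, ← Matrix.diagonal_one]
    congr 1
    funext i
    exact mul_inv_cancel₀ (by exact_mod_cast (hpos i).ne')
  have e : (1 - Uk * Ukᴴ) * U
      = (1 - Uk * Ukᴴ) * (L - Lk) * V * Matrix.diagonal (fun i => ((σ i)⁻¹ : ℂ)) := by
    rw [Matrix.mul_sub, h2, sub_zero, Matrix.mul_assoc _ L, h3, Matrix.mul_assoc, Matrix.mul_assoc,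
      h4, Matrix.mul_one]
  rw [e, div_eq_mul_inv]
  refine (Matrix.l2_opNorm_mul _ _).trans ?_
  have h5 : ‖(Matrix.diagonal (fun i => ((σ i)⁻¹ : ℂ)))‖ ≤ (σ ⟨r - 1, by omega⟩)⁻¹ := by
    rw [Matrix.l2_opNorm_diagonal, pi_norm_le_iff_of_nonneg (inv_nonneg.2 (hpos _).le)]
    intro i
    rw [norm_inv, Complex.norm_real, Real.norm_eq_abs, abs_of_pos (hpos i)]
    apply inv_anti₀ (hpos _)
    apply hord
    have := i.2
    rw [Fin.le_def]
    change i.1 ≤ r - 1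
    omega
  have h6 := norm_mul3 (1 - Uk * Ukᴴ) (L - Lk) V (coproj_norm Uk hUk) (iso_norm V hV)
  gcongr

lemma resid_norm {r : ℕ} (hr : 0 < r) (L Lk : Matrix m n ℂ) (U Uk : Matrix m (Fin r) ℂ)
    (σ σk : Fin r → ℝ)
    (V Vk : Matrix n (Fin r) ℂ) (h : IsSVD L U σ V) (hk : IsSVD Lk Uk σk Vk) :
    ‖tangentProj Uk Vk L - L‖ ≤ ‖L - Lk‖ / σ ⟨r - 1, by omega⟩ * ‖L - Lk‖ := by
  rw [tangent_resid L Lk U Uk σ σk V Vk h hk, norm_neg]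
  have ha := angle_bound hr L Lk U Uk σ σk V Vk h hk
  refine (Matrix.l2_opNorm_mul _ _).trans ?_
  have hp := h.2.2.1 ⟨r - 1, by omega⟩
  have hb := norm_mul3 Uᴴ (L - Lk) (1 - Vk * Vkᴴ)
    (by rw [Matrix.l2_opNorm_conjTranspose]; exact iso_norm U h.1) (coproj_norm Vk hk.2.1)
  gcongr

lemma rn_proj_mul {r : ℕ} {l : Type*} [Fintype l] [DecidableEq l]
    (U : Matrix m (Fin r) ℂ) (h : Uᴴ * U = 1) (M : Matrix m l ℂ)
    (a : ℝ) (i : m) (ha : rn U i ≤ a) : rn (U * Uᴴ * M) i ≤ a * ‖M‖ := by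
  rw [Matrix.mul_assoc]
  refine (rn_mul _ _ _).trans ?_
  have : ‖Uᴴ * M‖ ≤ ‖M‖ := by
    refine (Matrix.l2_opNorm_mul _ _).trans ?_
    rw [Matrix.l2_opNorm_conjTranspose]
    have := iso_norm U h
    exact mul_le_of_le_one_left (norm_nonneg _) this
  have h0 : 0 ≤ a := (rn_nonneg U i).trans ha
  gcongr

lemma resid_row {r : ℕ} (L Lk : Matrix m n ℂ) (U Uk : Matrix m (Fin r) ℂ)
    (σ σk : Fin r → ℝ)
    (V Vk : Matrix n (Fin r) ℂ) (h : IsSVD L U σ V) (hk : IsSVD Lk Uk σk Vk) (i : m)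
    (a b : ℝ) (hb0 : 0 ≤ b) (ha : rn U i ≤ a) (hb : rn Uk i ≤ b) :
    rn (tangentProj Uk Vk L - L) i ≤ (a + b) * ‖L - Lk‖ := by
  rw [tangent_resid L Lk U Uk σ σk V Vk h hk, rn_neg]
  refine (rn_mul _ _ _).trans ?_
  have hc := norm_mul3 Uᴴ (L - Lk) (1 - Vk * Vkᴴ)
    (by rw [Matrix.l2_opNorm_conjTranspose]; exact iso_norm U h.1) (coproj_norm Vk hk.2.1)
  have hd : rn ((1 - Uk * Ukᴴ) * U) i ≤ a + b := by
    rw [Matrix.sub_mul, Matrix.one_mul]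
    refine (rn_sub _ _ _).trans ?_
    have := rn_proj_mul Uk hk.1 U b i hb
    have h1 := iso_norm U h.1
    have : b * ‖U‖ ≤ b * 1 := by gcongr
    linarith
  have := rn_nonneg U i
  have := (rn_nonneg U i).trans ha
  gcongr

lemma tangent_row {r : ℕ} (E : Matrix m n ℂ) (Uk : Matrix m (Fin r) ℂ)
    (Vk : Matrix n (Fin r) ℂ) (hU : Ukᴴ * Uk = 1) (hV : Vkᴴ * Vk = 1) (i : m)
    (b S : ℝ) (hb0 : 0 ≤ b) (hb : rn Uk i ≤ b) (hb' : ∀ j, rn Vk j ≤ b)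
    (hE : ‖E‖ ≤ S) (hE' : ∑ j, ‖E i j‖ ≤ S) :
    rn (tangentProj Uk Vk E) i ≤ 3 * b * S := by
  rw [tangentProj]
  refine (rn_sub _ _ _).trans ?_
  have hQ : ‖Vk * Vkᴴ‖ ≤ 1 := herm_idem_norm _ (proj_idem Vk hV) (proj_herm Vk)
  have hVn : ‖Vkᴴ‖ ≤ 1 := by rw [Matrix.l2_opNorm_conjTranspose]; exact iso_norm Vk hV
  have h1 : rn (Uk * Ukᴴ * E) i ≤ b * S :=
    (rn_proj_mul Uk hU E b i hb).trans (by gcongr)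
  have h2 : rn (Uk * Ukᴴ * E * (Vk * Vkᴴ)) i ≤ b * S := by
    refine (rn_mul _ _ _).trans ?_
    have := mul_le_of_le_one_right (rn_nonneg (Uk * Ukᴴ * E) i) hQ
    linarith
  have h3 : rn (E * (Vk * Vkᴴ)) i ≤ b * S := by
    rw [← Matrix.mul_assoc]
    refine (rn_mul _ _ _).trans ?_
    have := mul_le_of_le_one_right (rn_nonneg (E * Vk) i) hVn
    have := rn_mul_l1 E Vk i S b hb0 hE' hb'
    linarith
  have := rn_add (Uk * Ukᴴ * E) (E * (Vk * Vkᴴ)) i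
  linarith

lemma hankel_row {n₁ n₂ n : ℕ} (hn : n + 1 = n₁ + n₂) (e : Fin n → ℂ) (i : Fin n₁) :
    ∑ j, ‖hankel hn e i j‖ ≤ ∑ t, ‖e t‖ := by
  have hinj : Function.Injective
      (fun j : Fin n₂ => (⟨i.1 + j.1, by have hi := i.2; have hj := j.2; omega⟩ : Fin n)) := by
    intro a b hab
    simp only [Fin.mk.injEq] at hab
    exact Fin.ext (by omega)
  have := Finset.sum_image (s := Finset.univ) (f := fun t => ‖e t‖) (hinj.injOn)
  refine le_trans (le_of_eq this.symm) ?_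
  exact Finset.sum_le_sum_of_subset_of_nonneg (Finset.subset_univ _) fun _ _ _ => norm_nonneg _

lemma hankel_col {n₁ n₂ n : ℕ} (hn : n + 1 = n₁ + n₂) (e : Fin n → ℂ) (j : Fin n₂) :
    ∑ i, ‖hankel hn e i j‖ ≤ ∑ t, ‖e t‖ := by
  have hinj : Function.Injective
      (fun i : Fin n₁ => (⟨i.1 + j.1, by have hi := i.2; have hj := j.2; omega⟩ : Fin n)) := by
    intro a b hab
    simp only [Fin.mk.injEq] at hab
    exact Fin.ext (by omega)
  have := Finset.sum_image (s := Finset.univ) (f := fun t => ‖e t‖) (hinj.injOn)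
  refine le_trans (le_of_eq this.symm) ?_
  exact Finset.sum_le_sum_of_subset_of_nonneg (Finset.subset_univ _) fun _ _ _ => norm_nonneg _

lemma thresh_l1 {n : ℕ} (x s xk : Fin n → ℂ) (ζ B δ α : ℝ) (hδ : ∀ t, ‖(x - xk) t‖ ≤ δ)
    (hζ : δ ≤ ζ) (hB : ζ + δ ≤ B) (hB0 : 0 ≤ B) (hs : IsSparse α s) :
    ∑ t, ‖(s - hardThreshold ζ (x + s - xk)) t‖ ≤ α * n * B := by
  classical
  have hpt : ∀ t, ‖(s - hardThreshold ζ (x + s - xk)) t‖ ≤ if s t ≠ 0 then B else 0 := by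
    intro t
    have h1 := hδ t
    simp only [Pi.sub_apply, hardThreshold, Pi.add_apply] at h1 ⊢
    by_cases h0 : s t = 0
    · simp only [h0, add_zero, ne_eq, not_true_eq_false, if_false]
      rw [if_neg (by linarith)]
      simp
    · rw [if_pos h0]
      split_ifs with hc
      · have : s t - (x t + s t - xk t) = -(x t - xk t) := by ring
        rw [this, norm_neg]
        linarith
      · push Not at hc
        have : s t - 0 = (x t + s t - xk t) - (x t - xk t) := by ring
        rw [this]
        refine (norm_sub_le _ _).trans ?_
        linarith
  calc _ ≤ ∑ t, (if s t ≠ 0 then B else 0) := Finset.sum_le_sum fun t _ => hpt t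
    _ = ((supp s).card : ℝ) * B := by
        rw [← Finset.sum_filter, Finset.sum_const, nsmul_eq_mul]
        congr!
    _ ≤ _ := by gcongr; exact hs

lemma row_count {n₁ r : ℕ} (U : Matrix (Fin n₁) (Fin r) ℂ) (h : Uᴴ * U = 1) (q : ℝ) (hq : 0 ≤ q)
    (hU : rowNorm U ≤ Real.sqrt q) : (r : ℝ) ≤ n₁ * q := by
  have h1 : ∀ j, ∑ i, ‖U i j‖ ^ 2 = (1 : ℝ) := by
    intro j
    have := congrFun (congrFun h j) j
    rw [Matrix.mul_apply, Matrix.one_apply_eq] at this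
    have h2 : ((∑ i, ‖U i j‖ ^ 2 : ℝ) : ℂ) = 1 := by
      rw [← this]; push_cast
      refine Finset.sum_congr rfl fun i _ => ?_
      rw [Matrix.conjTranspose_apply]
      exact (Complex.conj_mul' _).symm
    exact_mod_cast h2
  have h2 : ∀ i, ∑ j, ‖U i j‖ ^ 2 ≤ q := by
    intro i
    have := (rn_le_rowNorm U i).trans hU
    rw [rn] at this
    exact (Real.sqrt_le_sqrt_iff hq).1 this
  calc (r : ℝ) = ∑ j : Fin r, ∑ i, ‖U i j‖ ^ 2 := by simp [h1]
    _ = ∑ i, ∑ j, ‖U i j‖ ^ 2 := Finset.sum_comm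
    _ ≤ ∑ i : Fin n₁, q := Finset.sum_le_sum fun i _ => h2 i
    _ = _ := by simp

end Aux2

set_option maxHeartbeats 1000000

/-- spectral and `(2,∞)` norm bounds for
`(P_{T_k} − I)L + P_{T_k}ℋ(s − s_{k+1})`. -/
theorem statement13 :
    ∃ c : ℝ, 0 < c ∧
    ∀ (n₁ n₂ n r : ℕ) (hn : n + 1 = n₁ + n₂), 0 < n₁ → 0 < n₂ → (hr : 0 < r) →
    ∀ (μ α κ cs τ υ β : ℝ), 0 < μ → 0 < α →
    ∀ (x s : Fin n → ℂ)
      (U : Matrix (Fin n₁) (Fin r) ℂ) (σ : Fin r → ℝ) (V : Matrix (Fin n₂) (Fin r) ℂ),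
      IsSVD (hankel hn x) U σ V →
      cs = csConst n₁ n₂ n →
      rowNorm U ≤ Real.sqrt (μ * cs * r / n) →
      rowNorm V ≤ Real.sqrt (μ * cs * r / n) →
      κ = σ ⟨0, hr⟩ / σ ⟨r - 1, by omega⟩ →
      IsSparse α s →
      α ≤ c / (μ * cs * r * κ) ^ 2 →
      τ = 4 * α * μ * cs * r * κ →
      υ = 3 * τ * (2 * Real.sqrt (μ * cs * r) * κ + μ * cs * r * κ) →
      β = μ * cs * r / (2 * κ * n) →
    ∀ γ : ℝ, 4 * τ + Real.sqrt (1 / 12) ≤ γ → γ < 1 →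
    ∀ (k : ℕ) (Lk : Matrix (Fin n₁) (Fin n₂) ℂ) (xk : Fin n → ℂ)
      (Uk : Matrix (Fin n₁) (Fin r) ℂ) (σk : Fin r → ℝ) (Vk : Matrix (Fin n₂) (Fin r) ℂ),
      IsSVD Lk Uk σk Vk →
      rowNorm Uk ≤ Real.sqrt (4 * μ * κ ^ 2 * cs * r / n) →
      rowNorm Vk ≤ Real.sqrt (4 * μ * κ ^ 2 * cs * r / n) →
      specNorm (hankel hn x - Lk) ≤ 2 * τ * γ ^ k * σ ⟨r - 1, by omega⟩ →
      vecMaxNorm (x - xk) ≤ (τ - 2 * τ ^ 2) / (8 * α * κ * n) * γ ^ k * σ ⟨r - 1, by omega⟩ →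
      let s' := hardThreshold (β * γ ^ k * specNorm Lk) (x + s - xk)
      let Z := (tangentProj Uk Vk (hankel hn x) - hankel hn x)
                + tangentProj Uk Vk (hankel hn (s - s'))
      specNorm Z ≤ τ * γ ^ (k + 1) * σ ⟨r - 1, by omega⟩ ∧
      rowNorm Z ≤ υ * γ ^ k * σ ⟨r - 1, by omega⟩ / Real.sqrt n := by
  refine ⟨1, one_pos, ?_⟩
  intro n₁ n₂ n r hn hn₁ hn₂ hr μ α κ cs τ υ β hμ hα x s U σ V hsvd hcs hU hV hκ hsp _hαc hτ hυ hβ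
    γ hγ1 hγ2 k Lk xk Uk σk Vk hsvdk hUk hVk hLd hxd s' Z
  have hlast : r - 1 < r := by omega
  have hnpos : 0 < n := by omega
  have hnR : (0 : ℝ) < n := by exact_mod_cast hnpos
  have hwpos : 0 < σ ⟨r - 1, hlast⟩ := hsvd.2.2.1 _
  have hord : σ ⟨r - 1, hlast⟩ ≤ σ ⟨0, hr⟩ := hsvd.2.2.2.1 _ _ (Nat.zero_le _)
  have hLnorm : specNorm (hankel hn x) = σ ⟨0, hr⟩ := svd_norm hr _ U σ V hsvd
  have hres := resid_norm hr (hankel hn x) Lk U Uk σ σk V Vk hsvd hsvdk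
  rw [← specNorm_eq, ← specNorm_eq] at hres
  have hresrow := resid_row (hankel hn x) Lk U Uk σ σk V Vk hsvd hsvdk
  simp only [← specNorm_eq] at hresrow
  set w := σ ⟨r - 1, hlast⟩ with hw
  have hκ1 : 1 ≤ κ := by rw [hκ, le_div_iff₀ hwpos]; linarith
  have hκ0 : 0 < κ := by linarith
  have hσ0 : σ ⟨0, hr⟩ = κ * w := by rw [hκ]; field_simp
  have hcs0 : 0 < cs := by
    rw [hcs, csConst]
    exact lt_max_of_lt_left (by positivity)
  have hrR : (1 : ℝ) ≤ r := by exact_mod_cast hr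
  obtain ⟨M, hM⟩ : ∃ M, M = μ * cs * r := ⟨_, rfl⟩
  have hM0 : 0 < M := by rw [hM]; positivity
  rw [← hM] at hU hV hβ hυ
  have hτ' : τ = 4 * α * M * κ := by rw [hτ, hM]; ring
  have hτ0 : 0 < τ := by rw [hτ']; positivity
  have hρ0 : 0 < Real.sqrt (1 / 12) := Real.sqrt_pos.2 (by norm_num)
  have hγ0 : 0 < γ := by linarith
  obtain ⟨g, hg⟩ : ∃ g, g = γ ^ k := ⟨_, rfl⟩
  have hg0 : 0 < g := by rw [hg]; positivity
  have hg1 : g ≤ 1 := by rw [hg]; exact pow_le_one₀ hγ0.le hγ2.le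
  -- M ≥ 1
  have hM1 : 1 ≤ M := by
    have h1 := row_count U hsvd.1 (M / n) (by positivity) hU
    have h2 : (n₁ : ℝ) ≤ n := by exact_mod_cast (by omega : n₁ ≤ n)
    have h3 : (n₁ : ℝ) * (M / n) ≤ n * (M / n) := by gcongr
    have h4 : (n : ℝ) * (M / n) = M := by field_simp
    linarith
  -- bounds on the iterate
  rw [← hg] at hLd hxd
  have hdn : specNorm (hankel hn x - Lk) ≤ 2 * τ * g * w := hLd
  have hd0 : 0 ≤ specNorm (hankel hn x - Lk) := norm_nonneg _
  have hgw : g * w ≤ κ * w := by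
    have : g ≤ κ := by linarith
    gcongr
  have hτgw : 2 * τ * g * w ≤ 2 * τ * (κ * w) := by
    rw [mul_assoc]; gcongr
  have hLklo : (1 - 2 * τ) * (κ * w) ≤ specNorm Lk := by
    have h1 : specNorm (hankel hn x) ≤ specNorm (hankel hn x - Lk) + specNorm Lk := by
      have := specNorm_add (hankel hn x - Lk) Lk
      rwa [sub_add_cancel] at this
    rw [hLnorm, hσ0] at h1
    linarith
  have hLkhi : specNorm Lk ≤ (1 + 2 * τ) * (κ * w) := by
    have h1 : specNorm Lk ≤ specNorm (hankel hn x) + specNorm (hankel hn x - Lk) := by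
      have := specNorm_sub (hankel hn x) (hankel hn x - Lk)
      rwa [sub_sub_cancel] at this
    rw [hLnorm, hσ0] at h1
    linarith
  obtain ⟨δ, hδ⟩ : ∃ δ, δ = (τ - 2 * τ ^ 2) / (8 * α * κ * n) * g * w := ⟨_, rfl⟩
  have hδ' : δ = β * g * ((1 - 2 * τ) * (κ * w)) := by
    rw [hδ, hβ, hτ']; field_simp; ring
  have hxt : ∀ t, ‖(x - xk) t‖ ≤ δ := by
    intro t
    rw [hδ]
    refine le_trans ?_ hxd
    exact le_ciSup (f := fun t => ‖(x - xk) t‖) (Set.finite_range _).bddAbove t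
  have hβ0 : 0 < β := by rw [hβ]; positivity
  have hζlo : δ ≤ β * g * specNorm Lk := by rw [hδ']; gcongr
  have hB : β * g * specNorm Lk + δ ≤ M / n * g * w := by
    have h1 : β * g * specNorm Lk ≤ β * g * ((1 + 2 * τ) * (κ * w)) := by gcongr
    have h2 : β * g * ((1 + 2 * τ) * (κ * w)) + δ = M / n * g * w := by
      rw [hδ', hβ]; field_simp; ring
    linarith
  have hl1 : ∑ t, ‖(s - s') t‖ ≤ α * M * g * w := by
    have h1 := thresh_l1 x s xk (β * g * specNorm Lk) (M / n * g * w) δ α hxt hζlo hB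
      (by positivity) hsp
    have h2 : α * n * (M / n * g * w) = α * M * g * w := by field_simp
    rw [h2, hg] at h1
    rw [hg]
    exact h1
  obtain ⟨S, hS⟩ : ∃ S, S = α * M * g * w := ⟨_, rfl⟩
  rw [← hS] at hl1
  have hS0 : 0 < S := by rw [hS]; positivity
  have hSτ : 4 * κ * S = τ * g * w := by rw [hS, hτ']; ring
  have hErow : ∀ i, ∑ j, ‖hankel hn (s - s') i j‖ ≤ S := fun i => (hankel_row hn _ i).trans hl1
  have hEcol : ∀ j, ∑ i, ‖hankel hn (s - s') i j‖ ≤ S := fun j => (hankel_col hn _ j).trans hl1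
  have hE : specNorm (hankel hn (s - s')) ≤ S := schur_test _ S hS0.le hErow hEcol
  have hPE : specNorm (tangentProj Uk Vk (hankel hn (s - s')))
      ≤ 4 * Real.sqrt (1 / 12) * specNorm (hankel hn (s - s')) :=
    tangent_norm (Uk * Ukᴴ) (proj_idem Uk hsvdk.1) (proj_herm Uk) (Vk * Vkᴴ)
      (proj_idem Vk hsvdk.2.1) (proj_herm Vk) _
  constructor
  · have h1 : specNorm Z ≤ specNorm (tangentProj Uk Vk (hankel hn x) - hankel hn x)
        + specNorm (tangentProj Uk Vk (hankel hn (s - s'))) := by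
      exact specNorm_add _ _
    have h2 : specNorm (hankel hn x - Lk) / w * specNorm (hankel hn x - Lk)
        ≤ 4 * τ * (τ * g * w) := by
      calc _ ≤ (2 * τ * g * w) / w * (2 * τ * g * w) := by gcongr
        _ = 4 * τ * (τ * g * w) * g := by field_simp; ring
        _ ≤ 4 * τ * (τ * g * w) * 1 := by gcongr
        _ = _ := by ring
    have h3 : 4 * Real.sqrt (1 / 12) * specNorm (hankel hn (s - s'))
        ≤ Real.sqrt (1 / 12) * (τ * g * w) := by
      have h4 : 4 * S ≤ τ * g * w := by
        have := le_mul_of_one_le_left hS0.le hκ1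
        linarith
      calc _ ≤ 4 * Real.sqrt (1 / 12) * S := by gcongr
        _ = Real.sqrt (1 / 12) * (4 * S) := by ring
        _ ≤ _ := by gcongr
    have h5 : (4 * τ + Real.sqrt (1 / 12)) * (τ * g * w) ≤ γ * (τ * g * w) := by gcongr
    have h6 : τ * γ ^ (k + 1) * w = γ * (τ * g * w) := by rw [pow_succ, ← hg]; ring
    rw [h6]
    linarith
  · rw [← hg]
    have : Nonempty (Fin n₁) := ⟨⟨0, hn₁⟩⟩
    refine ciSup_le fun i => ?_
    change rn Z i ≤ _
    obtain ⟨q, hq⟩ : ∃ q, q = Real.sqrt (M / n) := ⟨_, rfl⟩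
    have hq0 : 0 ≤ q := by rw [hq]; positivity
    have hb : Real.sqrt (4 * μ * κ ^ 2 * cs * r / n) = 2 * κ * q := by
      rw [hq, show 4 * μ * κ ^ 2 * cs * r / n = (2 * κ) ^ 2 * (M / n) by rw [hM]; ring,
        Real.sqrt_mul (by positivity), Real.sqrt_sq (by positivity)]
    rw [hb] at hUk hVk
    rw [← hq] at hU
    have h1 := hresrow i q (2 * κ * q) (by positivity) ((rn_le_rowNorm U i).trans hU)
      ((rn_le_rowNorm Uk i).trans hUk)
    have h2 := tangent_row (hankel hn (s - s')) Uk Vk hsvdk.1 hsvdk.2.1 i (2 * κ * q) S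
      (by positivity) ((rn_le_rowNorm Uk i).trans hUk)
      (fun j => (rn_le_rowNorm Vk j).trans hVk) hE (hErow i)
    have h3 : rn Z i ≤ _ := rn_add (tangentProj Uk Vk (hankel hn x) - hankel hn x)
      (tangentProj Uk Vk (hankel hn (s - s'))) i
    have hsq : q = Real.sqrt M / Real.sqrt n := by rw [hq, Real.sqrt_div hM0.le]
    have hsn : 0 < Real.sqrt n := Real.sqrt_pos.2 hnR
    have hsM : Real.sqrt M ≤ M := by
      rw [Real.sqrt_le_left hM0.le]
      exact le_self_pow₀ hM1 (by norm_num)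
    have hsM0 : 0 ≤ Real.sqrt M := Real.sqrt_nonneg _
    have h4 : (q + 2 * κ * q) * specNorm (hankel hn x - Lk)
        ≤ (6 * τ * κ * Real.sqrt M) * (g * w) / Real.sqrt n := by
      calc _ ≤ (κ * q + 2 * κ * q) * (2 * τ * g * w) := by
            gcongr
            exact le_mul_of_one_le_left hq0 hκ1
        _ = _ := by rw [hsq]; ring
    have h5 : 3 * (2 * κ * q) * S ≤ (3 * τ * (M * κ)) * (g * w) / Real.sqrt n := by
      have e : 3 * (2 * κ * q) * S = 3 / 2 * Real.sqrt M * τ * (g * w) / Real.sqrt n := by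
        have : 3 * (2 * κ * q) * S = 3 / 2 * q * (4 * κ * S) := by ring
        rw [this, hSτ, hsq]; ring
      rw [e]
      apply div_le_div_of_nonneg_right _ hsn.le
      have h6 : 3 / 2 * Real.sqrt M ≤ 3 * (M * κ) := by
        have := le_mul_of_one_le_right hM0.le hκ1
        linarith
      calc _ = (3 / 2 * Real.sqrt M) * (τ * (g * w)) := by ring
        _ ≤ (3 * (M * κ)) * (τ * (g * w)) := by gcongr
        _ = _ := by ring
    have h7 : υ * g * w / Real.sqrt n = (6 * τ * κ * Real.sqrt M) * (g * w) / Real.sqrt n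
        + (3 * τ * (M * κ)) * (g * w) / Real.sqrt n := by
      rw [hυ]; ring
    rw [h7]
    linarith

end ASAP
end
end
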